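/- arXiv:1705.09475 — 2 statements merged into one kernel-verified Lean document; each statement's English description precedes it below -/
import Mathlib

section
/- Let G be a finite simple graph whose toughness is greater than 1, that is, every separating set S of G satisfies |S| > c(G − S). Suppose G contains a K₄-region with degree-3 vertex w and outer vertices a, b, c. Let G' be the graph obtained from G − w by adding six new vertices g₁, g₂, g₃, w₁, w₂, w₃ joined among themselves and to a, b, c exactly as the corresponding six non-outer vertices of T are joined among themselves and to o₁, o₂, o₃ (with a, b, c in the roles of o₁, o₂, o₃), i.e., by replacing the K₄-region by a T-region in the natural way. Then the toughness of G' is greater than 1, that is, every separating set S' of G' satisfies |S'| > c(G' − S'). -/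
/-- The number of connected components of `G − S`. -/
noncomputable def numComponents {V : Type*} (G : SimpleGraph V) (S : Set V) : ℕ :=
  Nat.card (G.induce Sᶜ).ConnectedComponent

/-- The graph `T` on nine vertices: `0,1,2` are the outer vertices `o₁,o₂,o₃`,
`3,4,5` are `g₁,g₂,g₃` and `6,7,8` are `w₁,w₂,w₃`. -/
def TGraph : SimpleGraph (Fin 9) :=
  SimpleGraph.fromRel fun a b =>
    (a, b) ∈ ([(0,1),(0,2),(1,2),(3,4),(3,5),(4,5),
      (3,0),(3,1),(4,1),(4,2),(5,2),(5,0),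
      (6,0),(6,1),(6,3),(7,1),(7,2),(7,4),
      (8,2),(8,0),(8,5)] : List (Fin 9 × Fin 9))

/-- The graph obtained from `G` by deleting the degree-3 vertex `w` of a
`K₄`-region with outer vertices `o 0, o 1, o 2` and adding six new vertices
(`Sum.inr 0,1,2` playing the roles of `g₁,g₂,g₃` and `Sum.inr 3,4,5` playing
the roles of `w₁,w₂,w₃`) joined among themselves and to `o 0, o 1, o 2`
exactly as the corresponding non-outer vertices of `T`;
i.e. the `K₄`-region is replaced by a `T`-region in the natural way. -/
def replaceK4byT {V : Type*} (G : SimpleGraph V) (w : V) (o : Fin 3 → V) :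
    SimpleGraph ((({w}ᶜ : Set V)) ⊕ Fin 6) :=
  SimpleGraph.fromRel fun x y =>
    match x, y with
    | Sum.inl u, Sum.inl v => G.Adj u.1 v.1
    | Sum.inl u, Sum.inr j => ∃ i : Fin 3, u.1 = o i ∧
        TGraph.Adj (i.castLE (by norm_num)) (j.addNat 3)
    | Sum.inr _, Sum.inl _ => False
    | Sum.inr i, Sum.inr j => TGraph.Adj (i.addNat 3) (j.addNat 3)

section ToughnessReplacement

open SimpleGraph

theorem card_le_numComponents_add {V C Y : Type*} [Finite V] [Finite Y]
    (G : SimpleGraph V) (S : Set V) (F : V → C) (ψ : Y → C)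
    (hF : ∀ u v, u ∉ S → v ∉ S → G.Adj u v → F u = F v)
    (hsurj : ∀ c, (∃ v, v ∉ S ∧ F v = c) ∨ ∃ y, ψ y = c) :
    Nat.card C ≤ numComponents G S + Nat.card Y := by
  have hwalk : ∀ (u v : (Sᶜ : Set V)), (G.induce Sᶜ).Walk u v → F u = F v := by
    intro u v p
    induction p with
    | nil => rfl
    | @cons a b _ h _ ih => exact (hF a b a.2 b.2 h).trans ih
  let Φ : (G.induce Sᶜ).ConnectedComponent ⊕ Y → C :=
    Sum.elim (ConnectedComponent.lift (fun v => F v) fun u v p _ => hwalk u v p) ψ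
  have hΦ : Function.Surjective Φ := by
    intro c
    rcases hsurj c with ⟨v, hv, rfl⟩ | ⟨y, rfl⟩
    · exact ⟨Sum.inl ((G.induce Sᶜ).connectedComponentMk ⟨v, hv⟩), rfl⟩
    · exact ⟨Sum.inr y, rfl⟩
  have := Nat.card_le_card_of_surjective Φ hΦ
  rwa [Nat.card_sum] at this

/-- The vertex `gᵢ` among the six new vertices. -/
def gVertex (i : Fin 3) : Fin 6 := i.castLE (by norm_num)

/-- The vertex `wᵢ` among the six new vertices. -/
def wVertex (i : Fin 3) : Fin 6 := i.addNat 3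

theorem eq_gVertex_or_eq_wVertex (k : Fin 6) :
    (∃ i, k = gVertex i) ∨ ∃ i, k = wVertex i := by
  revert k; decide

theorem eq_or_eq_add_one_or_eq_add_two (i j : Fin 3) : i = j ∨ i = j + 1 ∨ i = j + 2 := by
  revert i j; decide

section Adjacency

variable {V : Type*} (G : SimpleGraph V) (w : V) (o : Fin 3 → V)

theorem replaceK4byT_adj_inl {u v : ({w}ᶜ : Set V)} (h : G.Adj u v) :
    (replaceK4byT G w o).Adj (Sum.inl u) (Sum.inl v) := by
  refine ⟨?_, Or.inl h⟩
  rintro ⟨⟩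
  exact G.irrefl h

theorem replaceK4byT_adj_inl_inr (u : ({w}ᶜ : Set V)) (i : Fin 3) (k : Fin 6) (hu : u.1 = o i)
    (h : TGraph.Adj (i.castLE (by norm_num)) (k.addNat 3)) :
    (replaceK4byT G w o).Adj (Sum.inl u) (Sum.inr k) :=
  ⟨Sum.inl_ne_inr, Or.inl ⟨i, hu, h⟩⟩

theorem replaceK4byT_adj_inr {k l : Fin 6} (h : TGraph.Adj (k.addNat 3) (l.addNat 3)) :
    (replaceK4byT G w o).Adj (Sum.inr k) (Sum.inr l) := by
  refine ⟨?_, Or.inl h⟩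
  rintro ⟨⟩
  exact TGraph.irrefl h

theorem TGraph_adj_outer_gVertex (i : Fin 3) :
    TGraph.Adj (i.castLE (by norm_num)) ((gVertex i).addNat 3) := by
  simp only [TGraph, SimpleGraph.fromRel_adj]; revert i; decide

theorem TGraph_adj_outer_succ_gVertex (i : Fin 3) :
    TGraph.Adj ((i + 1).castLE (by norm_num)) ((gVertex i).addNat 3) := by
  simp only [TGraph, SimpleGraph.fromRel_adj]; revert i; decide

theorem TGraph_adj_outer_wVertex (i : Fin 3) :
    TGraph.Adj (i.castLE (by norm_num)) ((wVertex i).addNat 3) := by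
  simp only [TGraph, SimpleGraph.fromRel_adj]; revert i; decide

theorem TGraph_adj_outer_succ_wVertex (i : Fin 3) :
    TGraph.Adj ((i + 1).castLE (by norm_num)) ((wVertex i).addNat 3) := by
  simp only [TGraph, SimpleGraph.fromRel_adj]; revert i; decide

theorem TGraph_adj_gVertex_wVertex (i : Fin 3) :
    TGraph.Adj ((gVertex i).addNat 3) ((wVertex i).addNat 3) := by
  simp only [TGraph, SimpleGraph.fromRel_adj]; revert i; decide

theorem TGraph_adj_gVertex_gVertex {i j : Fin 3} (h : i ≠ j) :
    TGraph.Adj ((gVertex i).addNat 3) ((gVertex j).addNat 3) := by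
  simp only [TGraph, SimpleGraph.fromRel_adj]; revert i j; decide

end Adjacency

/-- A labelling `cl` of the vertices of `G'` that is constant on the components of `G' − S'` yields
a bound on the number of labels; `r` is the label given to `w`, and `ψ` provides extra labels. -/
theorem card_le_of_labelling {V C Y : Type*} [Finite V] [Finite Y] (G : SimpleGraph V) (w : V)
    (o : Fin 3 → V) (hw : ∀ i, o i ≠ w) (hdeg : ∀ v, G.Adj w v → ∃ i, v = o i)
    (S' : Set ((({w}ᶜ : Set V)) ⊕ Fin 6)) (cl : (({w}ᶜ : Set V)) ⊕ Fin 6 → C)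
    (hcl : ∀ x y, x ∉ S' → y ∉ S' → (replaceK4byT G w o).Adj x y → cl x = cl y)
    (hsurj : ∀ c, ∃ x, x ∉ S' ∧ cl x = c) (r : C) (ψ : Y → C)
    (hr : ∀ i, Sum.inl ⟨o i, hw i⟩ ∉ S' → cl (Sum.inl ⟨o i, hw i⟩) = r)
    (hnew : ∀ k, Sum.inr k ∉ S' →
      cl (Sum.inr k) = r ∨ ∃ y, ψ y = cl (Sum.inr k)) :
    Nat.card C ≤ numComponents G (Subtype.val '' (Sum.inl ⁻¹' S')) + Nat.card Y := by
  classical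
  have hmem : ∀ u : ({w}ᶜ : Set V),
      u.1 ∉ Subtype.val '' (Sum.inl ⁻¹' S' : Set ({w}ᶜ : Set V)) ↔ Sum.inl u ∉ S' := by
    intro u
    rw [Subtype.val_injective.mem_set_image, Set.mem_preimage]
  have hwX : w ∉ Subtype.val '' (Sum.inl ⁻¹' S' : Set ({w}ᶜ : Set V)) := by
    rintro ⟨u, -, hu⟩
    exact u.2 hu
  let F : V → C := fun v => if h : v = w then r else cl (Sum.inl ⟨v, h⟩)
  have hFw : F w = r := by simp [F]
  have hFu : ∀ v (h : v ≠ w), F v = cl (Sum.inl ⟨v, h⟩) := fun v h => by simp [F, h]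
  have hFadj : ∀ v, v ∉ Subtype.val '' (Sum.inl ⁻¹' S' : Set ({w}ᶜ : Set V)) →
      G.Adj w v → F v = r := by
    intro v hv h
    obtain ⟨i, rfl⟩ := hdeg v h
    rw [hFu _ (hw i)]
    exact hr i ((hmem ⟨o i, hw i⟩).1 hv)
  refine card_le_numComponents_add G _ F ψ ?_ ?_
  · intro u v hu hv h
    by_cases huw : u = w
    · subst huw
      rw [hFw, hFadj v hv h]
    by_cases hvw : v = w
    · subst hvw
      rw [hFw, hFadj u hu h.symm]
    rw [hFu u huw, hFu v hvw]
    exact hcl _ _ ((hmem ⟨u, huw⟩).1 hu) ((hmem ⟨v, hvw⟩).1 hv)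
      (replaceK4byT_adj_inl G w o h)
  · intro c
    obtain ⟨x | k, hx, rfl⟩ := hsurj c
    · exact Or.inl ⟨x, (hmem x).2 hx, hFu x x.2⟩
    · rcases hnew k hx with h | h
      · exact Or.inl ⟨w, hwX, hFw.trans h.symm⟩
      · exact Or.inr h

theorem card_le_or_of_labelling {V C : Type*} [Finite V] (G : SimpleGraph V) (w : V)
    (o : Fin 3 → V) (hinj : Function.Injective o) (hw : ∀ i, o i ≠ w)
    (hdeg : ∀ v, G.Adj w v → ∃ i, v = o i)
    (hK : ∀ i j, i ≠ j → G.Adj (o i) (o j))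
    (S' : Set ((({w}ᶜ : Set V)) ⊕ Fin 6)) (cl : (({w}ᶜ : Set V)) ⊕ Fin 6 → C)
    (hcl : ∀ x y, x ∉ S' → y ∉ S' → (replaceK4byT G w o).Adj x y → cl x = cl y)
    (hsurj : ∀ c, ∃ x, x ∉ S' ∧ cl x = c) (d : C) :
    Nat.card C ≤ numComponents G (Subtype.val '' (Sum.inl ⁻¹' S')) ∨
      (2 ≤ (Subtype.val '' (Sum.inl ⁻¹' S') : Set V).ncard ∧
        Nat.card C ≤ numComponents G (Subtype.val '' (Sum.inl ⁻¹' S')) +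
          (Sum.inr ⁻¹' S' : Set (Fin 6)).ncard) := by
  classical
  have hog : ∀ i, Sum.inl ⟨o i, hw i⟩ ∉ S' → Sum.inr (gVertex i) ∉ S' →
      cl (Sum.inl ⟨o i, hw i⟩) = cl (Sum.inr (gVertex i)) := fun i h h' =>
    hcl _ _ h h' (replaceK4byT_adj_inl_inr G w o _ i _ rfl (TGraph_adj_outer_gVertex i))
  have hog' : ∀ i, Sum.inl ⟨o (i + 1), hw _⟩ ∉ S' → Sum.inr (gVertex i) ∉ S' →
      cl (Sum.inl ⟨o (i + 1), hw _⟩) = cl (Sum.inr (gVertex i)) := fun i h h' =>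
    hcl _ _ h h' (replaceK4byT_adj_inl_inr G w o _ (i + 1) _ rfl
      (TGraph_adj_outer_succ_gVertex i))
  have how : ∀ i, Sum.inl ⟨o i, hw i⟩ ∉ S' → Sum.inr (wVertex i) ∉ S' →
      cl (Sum.inl ⟨o i, hw i⟩) = cl (Sum.inr (wVertex i)) := fun i h h' =>
    hcl _ _ h h' (replaceK4byT_adj_inl_inr G w o _ i _ rfl (TGraph_adj_outer_wVertex i))
  have how' : ∀ i, Sum.inl ⟨o (i + 1), hw _⟩ ∉ S' → Sum.inr (wVertex i) ∉ S' →
      cl (Sum.inl ⟨o (i + 1), hw _⟩) = cl (Sum.inr (wVertex i)) := fun i h h' =>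
    hcl _ _ h h' (replaceK4byT_adj_inl_inr G w o _ (i + 1) _ rfl
      (TGraph_adj_outer_succ_wVertex i))
  have hgw : ∀ i, Sum.inr (gVertex i) ∉ S' → Sum.inr (wVertex i) ∉ S' →
      cl (Sum.inr (gVertex i)) = cl (Sum.inr (wVertex i)) := fun i h h' =>
    hcl _ _ h h' (replaceK4byT_adj_inr G w o (TGraph_adj_gVertex_wVertex i))
  have hgg : ∀ i j, Sum.inr (gVertex i) ∉ S' → Sum.inr (gVertex j) ∉ S' →
      cl (Sum.inr (gVertex i)) = cl (Sum.inr (gVertex j)) := by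
    intro i j h h'
    rcases eq_or_ne i j with rfl | hij
    · rfl
    · exact hcl _ _ h h' (replaceK4byT_adj_inr G w o (TGraph_adj_gVertex_gVertex hij))
  have hoo : ∀ i j, Sum.inl ⟨o i, hw i⟩ ∉ S' → Sum.inl ⟨o j, hw j⟩ ∉ S' →
      cl (Sum.inl ⟨o i, hw i⟩) = cl (Sum.inl ⟨o j, hw j⟩) := by
    intro i j h h'
    rcases eq_or_ne i j with rfl | hij
    · rfl
    · exact hcl _ _ h h' (replaceK4byT_adj_inl G w o (hK i j hij))
  have htwo : ∀ i j, i ≠ j → Sum.inl ⟨o i, hw i⟩ ∈ S' → Sum.inl ⟨o j, hw j⟩ ∈ S' →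
      2 ≤ (Subtype.val '' (Sum.inl ⁻¹' S') : Set V).ncard := by
    intro i j hij hi hj
    rw [← Set.ncard_pair (hinj.ne hij)]
    refine Set.ncard_le_ncard ?_ (Set.toFinite _)
    rintro v (rfl | rfl)
    · exact ⟨⟨o i, hw i⟩, hi, rfl⟩
    · exact ⟨⟨o j, hw j⟩, hj, rfl⟩
  by_cases hall : ∀ i, Sum.inl ⟨o i, hw i⟩ ∈ S'
  · right
    refine ⟨htwo 0 1 (by decide) (hall 0) (hall 1), ?_⟩
    obtain ⟨r, hr⟩ : ∃ r, ∀ i, Sum.inr (gVertex i) ∉ S' → cl (Sum.inr (gVertex i)) = r := by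
      by_cases hg : ∃ i, Sum.inr (gVertex i) ∉ S'
      · obtain ⟨i, hi⟩ := hg
        exact ⟨_, fun j hj => hgg j i hj hi⟩
      · push Not at hg
        exact ⟨d, fun i hi => absurd (hg i) hi⟩
    let ψ : (Sum.inr ⁻¹' S' : Set (Fin 6)) → C := fun y => cl (Sum.inr (y.1 + 3))
    refine card_le_of_labelling G w o hw hdeg S' cl hcl hsurj r ψ
      (fun i hi => absurd (hall i) hi) ?_
    intro k hk
    rcases eq_gVertex_or_eq_wVertex k with ⟨i, rfl⟩ | ⟨i, rfl⟩
    · exact Or.inl (hr i hk)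
    · by_cases hg : Sum.inr (gVertex i) ∈ S'
      · have : gVertex i + 3 = wVertex i := (by decide : ∀ i, gVertex i + 3 = wVertex i) i
        exact Or.inr ⟨⟨gVertex i, hg⟩, by simp only [ψ, this]⟩
      · exact Or.inl ((hgw i hg hk).symm.trans (hr i hg))
  · push Not at hall
    obtain ⟨j, hj⟩ := hall
    by_cases hother : Sum.inl ⟨o (j + 1), hw _⟩ ∈ S' ∧ Sum.inl ⟨o (j + 2), hw _⟩ ∈ S'
    · right
      refine ⟨htwo _ _ ((by decide : ∀ j : Fin 3, j + 1 ≠ j + 2) j) hother.1 hother.2, ?_⟩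
      let ψ : (Sum.inr ⁻¹' S' : Set (Fin 6)) → C := fun _ =>
        if Sum.inr (gVertex (j + 1)) ∈ S' then cl (Sum.inr (wVertex (j + 1)))
        else cl (Sum.inr (gVertex (j + 1)))
      refine card_le_of_labelling G w o hw hdeg S' cl hcl hsurj (cl (Sum.inl ⟨o j, hw j⟩)) ψ
        (fun i hi => hoo i j hi hj) ?_
      have hj3 : j + 2 + 1 = j := (by decide : ∀ j : Fin 3, j + 2 + 1 = j) j
      have hg2 : Sum.inr (gVertex (j + 2)) ∉ S' →
          cl (Sum.inr (gVertex (j + 2))) = cl (Sum.inl ⟨o j, hw j⟩) := by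
        have := hog' (j + 2)
        simp only [hj3] at this
        exact fun h => (this hj h).symm
      have hw2 : Sum.inr (wVertex (j + 2)) ∉ S' →
          cl (Sum.inr (wVertex (j + 2))) = cl (Sum.inl ⟨o j, hw j⟩) := by
        have := how' (j + 2)
        simp only [hj3] at this
        exact fun h => (this hj h).symm
      have hg1 : Sum.inr (gVertex (j + 1)) ∉ S' →
          cl (Sum.inr (gVertex (j + 1))) = cl (Sum.inl ⟨o j, hw j⟩) ∨
            ∃ y, ψ y = cl (Sum.inr (gVertex (j + 1))) := by
        intro h
        by_cases hg : Sum.inr (gVertex j) ∈ S'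
        · exact Or.inr ⟨⟨gVertex j, hg⟩, if_neg h⟩
        · exact Or.inl ((hgg _ _ h hg).trans (hog j hj hg).symm)
      intro k hk
      rcases eq_gVertex_or_eq_wVertex k with ⟨i, rfl⟩ | ⟨i, rfl⟩ <;>
        rcases eq_or_eq_add_one_or_eq_add_two i j with rfl | rfl | rfl
      · exact Or.inl (hog _ hj hk).symm
      · exact hg1 hk
      · exact Or.inl (hg2 hk)
      · exact Or.inl (how _ hj hk).symm
      · by_cases hg : Sum.inr (gVertex (j + 1)) ∈ S'
        · exact Or.inr ⟨⟨_, hg⟩, if_pos hg⟩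
        · rw [← hgw _ hg hk]
          exact hg1 hg
      · exact Or.inl (hw2 hk)
    · left
      have hpair : ∀ i, Sum.inl ⟨o i, hw i⟩ ∉ S' ∨ Sum.inl ⟨o (i + 1), hw _⟩ ∉ S' := by
        intro i
        by_contra! hi
        rcases eq_or_eq_add_one_or_eq_add_two i j with rfl | rfl | rfl
        · exact hj hi.1
        · have hj2 : j + 1 + 1 = j + 2 := (by decide : ∀ j : Fin 3, j + 1 + 1 = j + 2) j
          simp only [hj2] at hi
          exact hother hi
        · have hj3 : j + 2 + 1 = j := (by decide : ∀ j : Fin 3, j + 2 + 1 = j) j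
          simp only [hj3] at hi
          exact hj hi.2
      have := card_le_of_labelling G w o hw hdeg S' cl hcl hsurj (cl (Sum.inl ⟨o j, hw j⟩))
        Empty.elim (fun i hi => hoo i j hi hj) (by
          intro k hk
          left
          rcases eq_gVertex_or_eq_wVertex k with ⟨i, rfl⟩ | ⟨i, rfl⟩ <;>
            rcases hpair i with hi | hi
          · exact (hog i hi hk).symm.trans (hoo _ _ hi hj)
          · exact (hog' i hi hk).symm.trans (hoo _ _ hi hj)
          · exact (how i hi hk).symm.trans (hoo _ _ hi hj)
          · exact (how' i hi hk).symm.trans (hoo _ _ hi hj))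
      simpa using this

theorem ncard_eq_ncard_image_val_add {V β : Type*} [Finite V] [Finite β] (s : Set V)
    (S' : Set (s ⊕ β)) :
    S'.ncard = (Subtype.val '' (Sum.inl ⁻¹' S') : Set V).ncard + (Sum.inr ⁻¹' S').ncard := by
  rw [Set.ncard_image_of_injective _ Subtype.val_injective,
    ← Set.ncard_image_of_injective (Sum.inl ⁻¹' S') (Sum.inl_injective (β := β)),
    ← Set.ncard_image_of_injective (Sum.inr ⁻¹' S') (Sum.inr_injective (α := s)),
    ← Set.ncard_union_eq ?_ (Set.toFinite _) (Set.toFinite _),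
    Set.image_preimage_inl_union_image_preimage_inr]
  rw [Set.disjoint_left]
  rintro _ ⟨a, -, rfl⟩ ⟨b, -, h⟩
  cases h

end ToughnessReplacement

/-- Replacing a `K₄`-region by a `T`-region preserves toughness greater
than `1`. -/
theorem replace_K4_by_T_preserves_toughness_gt_one
    {V : Type*} [Fintype V] (G : SimpleGraph V) (w : V) (o : Fin 3 → V)
    (hinj : Function.Injective o)
    (hadj : ∀ i, G.Adj w (o i))
    (hdeg : ∀ v, G.Adj w v → ∃ i, v = o i)
    (hK : ∀ i j, i ≠ j → G.Adj (o i) (o j))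
    (hG : ∀ S : Set V, ¬ (G.induce Sᶜ).Connected → numComponents G S < S.ncard) :
    ∀ S' : Set ((({w}ᶜ : Set V)) ⊕ Fin 6),
      ¬ ((replaceK4byT G w o).induce S'ᶜ).Connected →
        numComponents (replaceK4byT G w o) S' < S'.ncard := by
  intro S' hS'
  classical
  set G' := replaceK4byT G w o
  have hw : ∀ i, o i ≠ w := fun i => (hadj i).ne'
  have hcard := ncard_eq_ncard_image_val_add _ S'
  by_cases hne : Nonempty ((S'ᶜ : Set _))
  swap
  · have hall : ∀ x, x ∈ S' := fun x => by
      by_contra hx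
      exact hne ⟨⟨x, hx⟩⟩
    have : IsEmpty ((S'ᶜ : Set _)) := not_nonempty_iff.1 hne
    have : IsEmpty (G'.induce S'ᶜ).ConnectedComponent := Quot.instIsEmpty
    rw [numComponents, Nat.card_of_isEmpty, Set.ncard_pos (Set.toFinite _)]
    exact ⟨Sum.inr 0, hall _⟩
  · obtain ⟨x₀⟩ := id hne
    let d := (G'.induce S'ᶜ).connectedComponentMk x₀
    let cl : (({w}ᶜ : Set V)) ⊕ Fin 6 → (G'.induce S'ᶜ).ConnectedComponent := fun x =>
      if h : x ∈ S' then d else (G'.induce S'ᶜ).connectedComponentMk ⟨x, h⟩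
    have hcl : ∀ x (h : x ∉ S'), cl x = (G'.induce S'ᶜ).connectedComponentMk ⟨x, h⟩ :=
      fun x h => dif_neg h
    have hkey := card_le_or_of_labelling G w o hinj hw hdeg hK S' cl
      (by
        intro x y hx hy h
        rw [hcl x hx, hcl y hy]
        exact SimpleGraph.ConnectedComponent.sound (SimpleGraph.Adj.reachable h))
      (by
        intro c
        induction c using SimpleGraph.ConnectedComponent.ind with
        | _ v => exact ⟨v, v.2, hcl v v.2⟩) d
    by_cases hX : (G.induce (Subtype.val '' (Sum.inl ⁻¹' S') : Set V)ᶜ).Connected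
    · have hone : numComponents G (Subtype.val '' (Sum.inl ⁻¹' S') : Set V) = 1 := by
        have := hX.preconnected.subsingleton_connectedComponent
        obtain ⟨v⟩ := hX.nonempty
        exact Nat.card_eq_one_iff_unique.2
          ⟨this, ⟨SimpleGraph.connectedComponentMk _ v⟩⟩
      rcases hkey with h | ⟨h2, h⟩
      · refine absurd ?_ hS'
        have hsub : Subsingleton (G'.induce S'ᶜ).ConnectedComponent :=
          (Finite.card_le_one_iff_subsingleton).1 (h.trans_eq hone)
        exact { preconnected := fun u v =>
                  SimpleGraph.ConnectedComponent.exact (Subsingleton.elim _ _)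
                nonempty := hne }
      · rw [numComponents]
        omega
    · have := hG _ hX
      rw [show numComponents G' S' = Nat.card (G'.induce S'ᶜ).ConnectedComponent from rfl]
      omega
end

section
/- The graph F₂,₀ is 8/7-tough, that is, every separating set S of F₂,₀ satisfies |S| ≥ (8/7) · c(F₂,₀ − S). -/
/-- A graph `G` is `t`-tough if for every set `S` of vertices whose removal
disconnects the graph, one has `|S| ≥ t · c(G − S)`. -/
def IsTough {V : Type*} (t : ℝ) (G : SimpleGraph V) : Prop :=
  ∀ S : Set V, ¬ (G.induce Sᶜ).Connected → t * (numComponents G S : ℝ) ≤ (S.ncard : ℝ)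

/-- The graph `F₂,₀` on 15 vertices: `0,1,2` are the black triangle vertices
`b₁,b₂,b₃`; the first copy of the non-outer part of `T` has `g`-vertices
`3,4,5` and white (simplicial) vertices `6,7,8`; the second copy has
`g`-vertices `9,10,11` and white (simplicial) vertices `12,13,14`. -/
def F20 : SimpleGraph (Fin 15) :=
  SimpleGraph.fromRel fun a b =>
    (a, b) ∈ ([(0,1),(0,2),(1,2),
      (3,4),(3,5),(4,5),(3,0),(3,1),(4,1),(4,2),(5,2),(5,0),
      (6,0),(6,1),(6,3),(7,1),(7,2),(7,4),(8,2),(8,0),(8,5),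
      (9,10),(9,11),(10,11),(9,0),(9,1),(10,1),(10,2),(11,2),(11,0),
      (12,0),(12,1),(12,9),(13,1),(13,2),(13,10),(14,2),(14,0),(14,11)] :
        List (Fin 15 × Fin 15))

/-- If every vertex of `G − S` outside `R` can step, along a path of length at most two in `G − S`,
to a smaller vertex, then `R` meets every component of `G − S`. -/
theorem numComponents_le_card {V : Type*} [LinearOrder V] [WellFoundedLT V] (G : SimpleGraph V)
    (S : Set V) (R : Finset V)
    (h : ∀ v ∉ S, v ∉ R → ∃ w < v, w ∉ S ∧
      (G.Adj v w ∨ ∃ u ∉ S, G.Adj v u ∧ G.Adj u w)) :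
    numComponents G S ≤ R.card := by
  have key : ∀ v, ∀ hv : v ∉ S, ∃ r : R, ∃ hr : r.1 ∉ S,
      (G.induce Sᶜ).Reachable ⟨r.1, hr⟩ ⟨v, hv⟩ := by
    intro v
    induction v using WellFoundedLT.induction with
    | ind v ih =>
      intro hv
      by_cases hR : v ∈ R
      · exact ⟨⟨v, hR⟩, hv, .refl _⟩
      obtain ⟨w, hwv, hw, hadj⟩ := h v hv hR
      obtain ⟨r, hr, hrw⟩ := ih w hwv hw
      refine ⟨r, hr, hrw.trans ?_⟩
      have step : ∀ {a b : V} (ha : a ∉ S) (hb : b ∉ S), G.Adj a b →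
          (G.induce Sᶜ).Reachable ⟨b, hb⟩ ⟨a, ha⟩ := fun _ _ hab =>
        SimpleGraph.Adj.reachable (SimpleGraph.induce_adj.2 hab.symm)
      rcases hadj with hvw | ⟨u, hu, hvu, huw⟩
      · exact step hv hw hvw
      · exact (step hu hw huw).trans (step hv hu hvu)
  have key' : ∀ c : (G.induce Sᶜ).ConnectedComponent, ∃ r : R, ∃ hr : r.1 ∉ S,
      (G.induce Sᶜ).connectedComponentMk ⟨r.1, hr⟩ = c := by
    intro c
    induction c using SimpleGraph.ConnectedComponent.ind with
    | h v =>
      obtain ⟨r, hr, hrv⟩ := key v.1 v.2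
      exact ⟨r, hr, SimpleGraph.ConnectedComponent.sound hrv⟩
  choose f hf hfc using key'
  have hinj : Function.Injective f := by
    intro c d hcd
    rw [← hfc c, ← hfc d]
    congr 2
    exact congrArg Subtype.val hcd
  simpa [numComponents] using Nat.card_le_card_of_injective f hinj

/-- A graph with exactly one connected component is connected. -/
theorem connected_of_numComponents_eq_one {V : Type*} {G : SimpleGraph V} {S : Set V}
    (h : numComponents G S = 1) : (G.induce Sᶜ).Connected := by
  obtain ⟨hsub, ⟨c⟩⟩ := Nat.card_eq_one_iff_unique.1 h
  have : Nonempty ↥Sᶜ := c.ind fun v => ⟨v⟩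
  exact ⟨fun u v => SimpleGraph.ConnectedComponent.exact (Subsingleton.elim _ _)⟩

instance : DecidableRel F20.Adj := by
  unfold F20
  infer_instance

/-- Given which of the vertices `bᵢ`, `gᵢ`, `wᵢ` are present, the vertices of one copy (in the order
`g₁, g₂, g₃, w₁, w₂, w₃`) that have no smaller present vertex within distance two. -/
def copyRoots (b₁ b₂ b₃ g₁ g₂ g₃ w₁ w₂ w₃ : Bool) : Fin 6 → Bool :=
  ![g₁ && !(b₁ || b₂ || b₃ && (g₂ || g₃)),
    g₂ && !(b₂ || b₃ || g₁ || b₁ && g₃),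
    g₃ && !(b₃ || b₁ || g₁ || g₂),
    w₁ && !(b₁ || b₂ || g₁),
    w₂ && !(b₂ || b₃ || g₂),
    w₃ && !(b₃ || b₁ || g₃)]

/-- The number of roots in one copy, in terms of the number of removed vertices of the copy. -/
theorem copyRoots_bounds : ∀ b₁ b₂ b₃ g₁ g₂ g₃ w₁ w₂ w₃ : Bool,
    let k := ∑ i, (copyRoots b₁ b₂ b₃ g₁ g₂ g₃ w₁ w₂ w₃ i).toNat
    let r := (!g₁).toNat + (!g₂).toNat + (!g₃).toNat + (!w₁).toNat + (!w₂).toNat + (!w₃).toNat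
    let b := b₁.toNat + b₂.toNat + b₃.toNat
    (2 ≤ b → k = 0) ∧ (b = 1 → k ≤ 1 ∧ k ≤ r) ∧ k ≤ 3 ∧ k ≤ r + 1 := by
  decide +kernel

/-- The vertices of `F20` chosen to represent the components, given which vertices are present. -/
def F20Roots (p : Fin 15 → Bool) : Fin 15 → Bool :=
  Fin.append (m := 9) (n := 6)
    (Fin.append (m := 3) (n := 6) ![p 0, p 1 && !p 0, p 2 && !(p 0 || p 1)]
      (copyRoots (p 0) (p 1) (p 2) (p 3) (p 4) (p 5) (p 6) (p 7) (p 8)))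
    (copyRoots (p 0) (p 1) (p 2) (p 9) (p 10) (p 11) (p 12) (p 13) (p 14))

/-- Either there is at most one root, or the number of roots satisfies the toughness bound. -/
theorem sum_F20Roots (p : Fin 15 → Bool) :
    ∑ i, (F20Roots p i).toNat ≤ 1 ∨
      8 * ∑ i, (F20Roots p i).toNat ≤ 7 * ∑ i, (!p i).toNat := by
  have h₁ := copyRoots_bounds (p 0) (p 1) (p 2) (p 3) (p 4) (p 5) (p 6) (p 7) (p 8)
  have h₂ := copyRoots_bounds (p 0) (p 1) (p 2) (p 9) (p 10) (p 11) (p 12) (p 13) (p 14)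
  have hsum : ∑ i, (F20Roots p i).toNat =
      ((p 0).toNat + (p 1 && !p 0).toNat + (p 2 && !(p 0 || p 1)).toNat) +
      ∑ i, (copyRoots (p 0) (p 1) (p 2) (p 3) (p 4) (p 5) (p 6) (p 7) (p 8) i).toNat +
      ∑ i, (copyRoots (p 0) (p 1) (p 2) (p 9) (p 10) (p 11) (p 12) (p 13) (p 14) i).toNat := by
    rw [show (∑ i, (F20Roots p i).toNat) = ∑ i : Fin (3 + 6 + 6), (F20Roots p i).toNat from rfl,
      Fin.sum_univ_add, Fin.sum_univ_add]
    simp only [F20Roots, Fin.append_left, Fin.append_right, Fin.sum_univ_three]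
    rfl
  have hrem : ∑ i, (!p i).toNat =
      ((!p 0).toNat + (!p 1).toNat + (!p 2).toNat) +
      ((!p 3).toNat + (!p 4).toNat + (!p 5).toNat + (!p 6).toNat + (!p 7).toNat + (!p 8).toNat) +
      ((!p 9).toNat + (!p 10).toNat + (!p 11).toNat + (!p 12).toNat + (!p 13).toNat +
        (!p 14).toNat) := by
    simp only [Fin.sum_univ_succ, Fin.sum_univ_zero]
    simp
    ring
  rw [hsum, hrem]
  dsimp only at h₁ h₂
  generalize ∑ i, (copyRoots (p 0) (p 1) (p 2) (p 3) (p 4) (p 5) (p 6) (p 7) (p 8) i).toNat = k₁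
    at h₁ ⊢
  generalize ∑ i, (copyRoots (p 0) (p 1) (p 2) (p 9) (p 10) (p 11) (p 12) (p 13) (p 14) i).toNat
    = k₂ at h₂ ⊢
  clear hsum hrem
  generalize p 0 = b₁ at *
  generalize p 1 = b₂ at *
  generalize p 2 = b₃ at *
  cases b₁ <;> cases b₂ <;> cases b₃ <;> simp at h₁ h₂ ⊢ <;> omega

/-- A present vertex that is not a root has a smaller present vertex within distance two. -/
theorem exists_lt_of_F20Roots_eq_false (p : Fin 15 → Bool) (v : Fin 15) (hv : p v = true)
    (hroot : F20Roots p v = false) :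
    ∃ w < v, p w = true ∧
      (F20.Adj v w ∨ ∃ u, p u = true ∧ F20.Adj v u ∧ F20.Adj u w) := by
  have near : ∀ w, p w = true → w < v ∧ F20.Adj v w → ∃ w < v, p w = true ∧
      (F20.Adj v w ∨ ∃ u, p u = true ∧ F20.Adj v u ∧ F20.Adj u w) :=
    fun w hp hw => ⟨w, hw.1, hp, .inl hw.2⟩
  have far : ∀ w u, p w = true → p u = true → w < v ∧ F20.Adj v u ∧ F20.Adj u w →
      ∃ w < v, p w = true ∧ (F20.Adj v w ∨ ∃ u, p u = true ∧ F20.Adj v u ∧ F20.Adj u w) :=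
    fun w u hw hu huw => ⟨w, huw.1, hw, .inr ⟨u, hu, huw.2⟩⟩
  have blocked : ∀ {a b : Bool}, a = true → (a && !b) = false → b = true := by decide
  fin_cases v
  · exact absurd hv (ne_true_of_eq_false hroot)
  · have h : (p 0) = true := blocked hv hroot
    exact near 0 h (by decide)
  · have h : (p 0 || p 1) = true := blocked hv hroot
    simp only [Bool.or_eq_true] at h
    obtain h | h := h
    · exact near 0 h (by decide)
    · exact near 1 h (by decide)
  · have h : (p 0 || p 1 || p 2 && (p 4 || p 5)) = true := blocked hv hroot
    simp only [Bool.or_eq_true, Bool.and_eq_true] at h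
    obtain (h | h) | ⟨h, h' | h'⟩ := h
    · exact near 0 h (by decide)
    · exact near 1 h (by decide)
    · exact far 2 4 h h' (by decide)
    · exact far 2 5 h h' (by decide)
  · have h : (p 1 || p 2 || p 3 || p 0 && p 5) = true := blocked hv hroot
    simp only [Bool.or_eq_true, Bool.and_eq_true] at h
    obtain ((h | h) | h) | ⟨h, h'⟩ := h
    · exact near 1 h (by decide)
    · exact near 2 h (by decide)
    · exact near 3 h (by decide)
    · exact far 0 5 h h' (by decide)
  · have h : (p 2 || p 0 || p 3 || p 4) = true := blocked hv hroot
    simp only [Bool.or_eq_true] at h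
    obtain ((h | h) | h) | h := h
    · exact near 2 h (by decide)
    · exact near 0 h (by decide)
    · exact near 3 h (by decide)
    · exact near 4 h (by decide)
  · have h : (p 0 || p 1 || p 3) = true := blocked hv hroot
    simp only [Bool.or_eq_true] at h
    obtain (h | h) | h := h
    · exact near 0 h (by decide)
    · exact near 1 h (by decide)
    · exact near 3 h (by decide)
  · have h : (p 1 || p 2 || p 4) = true := blocked hv hroot
    simp only [Bool.or_eq_true] at h
    obtain (h | h) | h := h
    · exact near 1 h (by decide)
    · exact near 2 h (by decide)
    · exact near 4 h (by decide)
  · have h : (p 2 || p 0 || p 5) = true := blocked hv hroot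
    simp only [Bool.or_eq_true] at h
    obtain (h | h) | h := h
    · exact near 2 h (by decide)
    · exact near 0 h (by decide)
    · exact near 5 h (by decide)
  · have h : (p 0 || p 1 || p 2 && (p 10 || p 11)) = true := blocked hv hroot
    simp only [Bool.or_eq_true, Bool.and_eq_true] at h
    obtain (h | h) | ⟨h, h' | h'⟩ := h
    · exact near 0 h (by decide)
    · exact near 1 h (by decide)
    · exact far 2 10 h h' (by decide)
    · exact far 2 11 h h' (by decide)
  · have h : (p 1 || p 2 || p 9 || p 0 && p 11) = true := blocked hv hroot
    simp only [Bool.or_eq_true, Bool.and_eq_true] at h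
    obtain ((h | h) | h) | ⟨h, h'⟩ := h
    · exact near 1 h (by decide)
    · exact near 2 h (by decide)
    · exact near 9 h (by decide)
    · exact far 0 11 h h' (by decide)
  · have h : (p 2 || p 0 || p 9 || p 10) = true := blocked hv hroot
    simp only [Bool.or_eq_true] at h
    obtain ((h | h) | h) | h := h
    · exact near 2 h (by decide)
    · exact near 0 h (by decide)
    · exact near 9 h (by decide)
    · exact near 10 h (by decide)
  · have h : (p 0 || p 1 || p 9) = true := blocked hv hroot
    simp only [Bool.or_eq_true] at h
    obtain (h | h) | h := h
    · exact near 0 h (by decide)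
    · exact near 1 h (by decide)
    · exact near 9 h (by decide)
  · have h : (p 1 || p 2 || p 10) = true := blocked hv hroot
    simp only [Bool.or_eq_true] at h
    obtain (h | h) | h := h
    · exact near 1 h (by decide)
    · exact near 2 h (by decide)
    · exact near 10 h (by decide)
  · have h : (p 2 || p 0 || p 11) = true := blocked hv hroot
    simp only [Bool.or_eq_true] at h
    obtain (h | h) | h := h
    · exact near 2 h (by decide)
    · exact near 0 h (by decide)
    · exact near 11 h (by decide)

/-- The graph `F₂,₀` is `8/7`-tough. -/
theorem F20_is_eight_sevenths_tough : IsTough (8 / 7) F20 := by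
  classical
  intro S hS
  let p : Fin 15 → Bool := fun i => decide (i ∉ S)
  have hle := numComponents_le_card F20 S (Finset.univ.filter fun i => F20Roots p i = true) (by
    intro v hv hR
    simpa [p] using exists_lt_of_F20Roots_eq_false p v (by simpa [p] using hv) (by simpa using hR))
  have hcard : (Finset.univ.filter fun i => F20Roots p i = true).card =
      ∑ i, (F20Roots p i).toNat := by
    rw [Finset.card_filter]
    exact Finset.sum_congr rfl fun i _ => by cases F20Roots p i <;> rfl
  have hncard : S.ncard = ∑ i, (!p i).toNat := by
    rw [Set.ncard_eq_toFinset_card', ← Set.filter_mem_univ_eq_toFinset, Finset.card_filter]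
    exact Finset.sum_congr rfl fun i _ => by by_cases h : i ∈ S <;> simp [p, h]
  have hne : numComponents F20 S ≠ 1 := fun h => hS (connected_of_numComponents_eq_one h)
  have hbound : 8 * numComponents F20 S ≤ 7 * S.ncard := by
    have := sum_F20Roots p
    omega
  have : (8 * numComponents F20 S : ℝ) ≤ 7 * S.ncard := by exact_mod_cast hbound
  linarith
end
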